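/- Let p0, p1, p2 ∈ R_{2,1} have no common zeros on P^1 × P^1 and be non-generic, and let I = ⟨p0, p1, p2⟩. Then I has the minimal bigraded free resolution 0 → R(−6,−3) → R(−4,−3)^2 ⊕ R(−6,−2)^2 → R(−6,−1) ⊕ R(−4,−2)^3 ⊕ R(−2,−3) → R(−2,−1)^3 → I → 0. Concretely: there exist a 3×5 matrix M1, a 5×4 matrix M2, and a 4×1 matrix M3 over R such that, assigning to the rows of M1 the bidegrees (2,1), (2,1), (2,1), to the columns of M1 (= rows of M2) the bidegrees (6,1), (4,2), (4,2), (4,2), (2,3), to the columns of M2 (= rows of M3) the bidegrees (4,3), (4,3), (6,2), (6,2), and to the column of M3 the bidegree (6,3), every matrix entry is bihomogeneous of bidegree equal to its column bidegree minus its row bidegree (and is 0 whenever this difference has a negative coordinate), and the complex 0 → R →(M3) R^4 →(M2) R^5 →(M1) R^3 →(A ↦ A0 p0 + A1 p1 + A2 p2) R is exact at R^4, R^5, and R^3, the map M3 is injective, and the image of the last map is I. -/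

import Mathlib

open MvPolynomial

noncomputable section

/-- The bigraded polynomial ring `R = k[x,y,z,w]`; variables `0,1,2,3` are `x,y,z,w`. -/
abbrev Rk (k : Type*) [Field k] := MvPolynomial (Fin 4) k

/-- The bigrading: `x, y` have degree `(1,0)`; `z, w` have degree `(0,1)`. -/
def bidegWt : Fin 4 → ℤ × ℤ := ![(1, 0), (1, 0), (0, 1), (0, 1)]

/-- `p` is bihomogeneous of bidegree `(m, n)` (with the convention that only the zero
polynomial is bihomogeneous of a bidegree with a negative coordinate). -/
def Bihom {k : Type*} [Field k] (p : Rk k) (m n : ℤ) : Prop :=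
  p.IsWeightedHomogeneous bidegWt (m, n)

/-- `p0, p1, p2` have no common zeros on `ℙ¹ × ℙ¹`. -/
def NoCommonZeros {k : Type*} [Field k] (p0 p1 p2 : Rk k) : Prop :=
  ∀ a b c d : k, (a, b) ≠ (0, 0) → (c, d) ≠ (0, 0) →
    eval ![a, b, c, d] p0 ≠ 0 ∨ eval ![a, b, c, d] p1 ≠ 0 ∨ eval ![a, b, c, d] p2 ≠ 0

/-- The map `(A0, A1, A2) ↦ A0 p0 + A1 p1 + A2 p2`, as a `k`-linear map on `R³`. -/
def syzMapk {k : Type*} [Field k] (p : Fin 3 → Rk k) : (Fin 3 → Rk k) →ₗ[k] Rk k :=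
  ∑ i : Fin 3, (LinearMap.mulRight k (p i)).comp (LinearMap.proj i)

/-- The bigraded piece `Syz(p)_{m,n}`: triples `(A0, A1, A2)` of bihomogeneous polynomials of
bidegree `(m-2, n-1)` with `A0 p0 + A1 p1 + A2 p2 = 0`, as a `k`-subspace of `R³`. -/
def SyzPiece {k : Type*} [Field k] (p : Fin 3 → Rk k) (m n : ℤ) :
    Submodule k (Fin 3 → Rk k) :=
  (Submodule.pi Set.univ fun _ => weightedHomogeneousSubmodule k bidegWt (m - 2, n - 1)) ⊓
    LinearMap.ker (syzMapk p)

/-- The syzygy module `Syz(p)`, as an `R`-submodule of `R³`. -/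
def Syz {k : Type*} [Field k] (p : Fin 3 → Rk k) : Submodule (Rk k) (Fin 3 → Rk k) :=
  LinearMap.ker (∑ i : Fin 3, (LinearMap.mulRight (Rk k) (p i)).comp (LinearMap.proj i))

/-- The Koszul submodule of `R³`: the `R`-submodule generated by the three Koszul syzygies
`(p1, −p0, 0)`, `(p2, 0, −p0)`, `(0, p2, −p1)`. -/
def KoszulSub {k : Type*} [Field k] (p0 p1 p2 : Rk k) : Submodule (Rk k) (Fin 3 → Rk k) :=
  Submodule.span (Rk k) {![p1, -p0, 0], ![p2, 0, -p0], ![0, p2, -p1]}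

/-- `p0, p1, p2 ∈ R_{2,1}` are generic: only finitely many points `[a0 : a1 : a2]` of `ℙ²(k)`
are such that `a0 p0 + a1 p1 + a2 p2` factors as `q · l` with `q ∈ R_{2,0}`, `l ∈ R_{0,1}`. -/
def BidegGeneric {k : Type*} [Field k] (p0 p1 p2 : Rk k) : Prop :=
  {P : Projectivization k (Fin 3 → k) |
    ∃ q l : Rk k, Bihom q 2 0 ∧ Bihom l 0 1 ∧
      P.rep 0 • p0 + P.rep 1 • p1 + P.rep 2 • p2 = q * l}.Finite

/-- Bidegrees of the columns of `M1` (= rows of `M2`) in the non-generic resolution: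
`(6,1), (4,2), (4,2), (4,2), (2,3)`. -/
def ngColDeg1 : Fin 5 → ℤ × ℤ := ![(6, 1), (4, 2), (4, 2), (4, 2), (2, 3)]

/-- Bidegrees of the columns of `M2` (= rows of `M3`) in the non-generic resolution:
`(4,3), (4,3), (6,2), (6,2)`. -/
def ngColDeg2 : Fin 4 → ℤ × ℤ := ![(4, 3), (4, 3), (6, 2), (6, 2)]

/-- Data witnessing that `u, v, z, w` behave like a regular sequence in every relevant order:
`u, v` have only the Koszul relation, and `z`, `w` are the kernels of retractions of `R` that
fix the other elements. -/
structure RegularQuad {R : Type*} [CommRing R] (u v z w : R) where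
  /-- the retraction killing `z` -/
  σz : R →+* R
  /-- the retraction killing `w` -/
  σw : R →+* R
  σz_dvd : ∀ r, z ∣ r - σz r
  σw_dvd : ∀ r, w ∣ r - σw r
  σz_z : σz z = 0
  σz_w : σz w = w
  σz_u : σz u = u
  σz_v : σz v = v
  σw_w : σw w = 0
  σw_z : σw z = z
  σw_u : σw u = u
  σw_v : σw v = v
  z_ne : z ≠ 0
  w_ne : w ≠ 0
  v_ne : v ≠ 0
  koszul : ∀ a b, u * a + v * b = 0 → ∃ t, a = v * t ∧ b = -(u * t)

/-- First syzygies of `z u, w u + z v, w v`. -/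
def syzMat1 {R : Type*} [CommRing R] (u v z w : R) : Matrix (Fin 3) (Fin 5) R :=
  !![v ^ 2, w * u + z * v, w * v, 0, w ^ 2;
     -(u * v), -(z * u), 0, w * v, -(z * w);
     u ^ 2, 0, -(z * u), -(w * u + z * v), z ^ 2]

/-- Second syzygies of `z u, w u + z v, w v`. -/
def syzMat2 {R : Type*} [CommRing R] (u v z w : R) : Matrix (Fin 5) (Fin 4) R :=
  !![0, 0, -z, -w;
     w, 0, v, 0;
     -z, w, -u, v;
     0, -z, 0, -u;
     -u, -v, 0, 0]

/-- Third syzygies of `z u, w u + z v, w v`. -/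
def syzMat3 {R : Type*} [CommRing R] (u v z w : R) : Matrix (Fin 4) (Fin 1) R :=
  !![v; -u; -w; z]

section Abstract

variable {R : Type*} [CommRing R] [IsDomain R] {u v z w : R}

theorem exists_eq_combination_of_mul_eq (σ : R →+* R) (hσ : ∀ r, w ∣ r - σ r) (hw : σ w = 0)
    (hu : σ u = u) (hv : σ v = v) (hw0 : w ≠ 0)
    (huv : ∀ a b, u * a + v * b = 0 → ∃ t, a = v * t ∧ b = -(u * t))
    {b p q : R} (h : w * b = u * p + v * q) : ∃ p' q', b = u * p' + v * q' := by
  have h' : u * σ p + v * σ q = 0 := by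
    have := congrArg σ h
    simp only [map_mul, map_add, hw, hu, hv, zero_mul] at this
    exact this.symm
  obtain ⟨t, hp, hq⟩ := huv _ _ h'
  obtain ⟨p', hp'⟩ := hσ p
  obtain ⟨q', hq'⟩ := hσ q
  refine ⟨p', q', mul_left_cancel₀ hw0 ?_⟩
  linear_combination h + u * hp' + v * hq' + u * hp + v * hq

namespace RegularQuad

theorem koszul_zw (H : RegularQuad u v z w) {a b : R} (h : z * a + w * b = 0) :
    ∃ t, a = w * t ∧ b = -(z * t) := by
  have h' := congrArg H.σw h
  simp only [map_mul, map_add, H.σw_w, H.σw_z, zero_mul, add_zero, map_zero, mul_eq_zero,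
    H.z_ne, false_or] at h'
  obtain ⟨t, ht⟩ := H.σw_dvd a
  refine ⟨t, by linear_combination ht + h', mul_left_cancel₀ H.w_ne ?_⟩
  linear_combination h - z * ht - z * h'

theorem mem_of_z_mul (H : RegularQuad u v z w) {b p q : R} (h : z * b = u * p + v * q) :
    ∃ p' q', b = u * p' + v * q' :=
  exists_eq_combination_of_mul_eq H.σz H.σz_dvd H.σz_z H.σz_u H.σz_v H.z_ne H.koszul h

theorem mem_of_w_mul (H : RegularQuad u v z w) {b p q : R} (h : w * b = u * p + v * q) :
    ∃ p' q', b = u * p' + v * q' :=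
  exists_eq_combination_of_mul_eq H.σw H.σw_dvd H.σw_w H.σw_u H.σw_v H.w_ne H.koszul h

/-- `z, w` is a regular sequence modulo `(u, v)`. -/
theorem koszul_zw_mod (H : RegularQuad u v z w) {b₁ b₂ s t : R}
    (h : z * b₁ + w * b₂ = u * t + v * s) :
    ∃ c d₁ d₂ e₁ e₂, b₁ = w * c + d₁ * u + d₂ * v ∧ b₂ = -(z * c) + e₁ * u + e₂ * v := by
  have h' := congrArg H.σw h
  simp only [map_mul, map_add, H.σw_w, H.σw_z, H.σw_u, H.σw_v, zero_mul, add_zero] at h'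
  obtain ⟨d₁, d₂, hd⟩ := H.mem_of_z_mul h'
  obtain ⟨c, hc⟩ := H.σw_dvd b₁
  have h'' : w * (b₂ + z * c) = u * (t - z * d₁) + v * (s - z * d₂) := by
    linear_combination h - z * hc - z * hd
  obtain ⟨e₁, e₂, he⟩ := H.mem_of_w_mul h''
  exact ⟨c, d₁, d₂, e₁, e₂, by linear_combination hc + hd, by linear_combination he⟩

/-- `z u, w v` have only the Koszul relation. -/
theorem koszul_zu_wv (H : RegularQuad u v z w) (hu : u ≠ 0) {a b : R}
    (h : z * u * a = w * v * b) : ∃ t, a = w * v * t ∧ b = z * u * t := by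
  have ha := congrArg H.σw h
  simp only [map_mul, H.σw_w, H.σw_z, H.σw_u, zero_mul, mul_eq_zero, H.z_ne, hu, or_self,
    false_or] at ha
  have hb := congrArg H.σz h
  simp only [map_mul, H.σz_w, H.σz_z, H.σz_v, zero_mul] at hb
  have hb' : H.σz b = 0 := by
    have := hb.symm
    simpa [H.w_ne, H.v_ne] using this
  obtain ⟨a', ha'⟩ := H.σw_dvd a
  obtain ⟨b', hb''⟩ := H.σz_dvd b
  rw [ha, sub_zero] at ha'
  rw [hb', sub_zero] at hb''
  have h' : u * a' + v * (-b') = 0 := by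
    apply mul_left_cancel₀ (mul_ne_zero H.z_ne H.w_ne)
    rw [ha', hb''] at h
    linear_combination h
  obtain ⟨t, h₁, h₂⟩ := H.koszul _ _ h'
  exact ⟨t, by rw [ha', h₁]; ring, by rw [hb'', neg_inj.mp h₂]; ring⟩

theorem syzMat3_injective (H : RegularQuad u v z w) :
    Function.Injective fun x : Fin 1 → R => (syzMat3 u v z w).mulVec x := by
  intro x y h
  have := congrFun h 3
  simp only [syzMat3, Matrix.mulVec, dotProduct, Fin.sum_univ_one] at this
  have h' := mul_left_cancel₀ (show (z : R) ≠ 0 from H.z_ne) this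
  ext i
  fin_cases i
  exact h'

theorem syzMat2_exact (H : RegularQuad u v z w) (a : Fin 4 → R) :
    (syzMat2 u v z w).mulVec a = 0 ↔ ∃ x : Fin 1 → R, a = (syzMat3 u v z w).mulVec x := by
  constructor
  · intro h
    have e0 := congrFun h 0
    have e1 := congrFun h 1
    have e4 := congrFun h 4
    simp [syzMat2, Matrix.mulVec, dotProduct, Fin.sum_univ_succ] at e0 e1 e4
    obtain ⟨t, ht2, ht3⟩ := H.koszul_zw (a := -a 2) (b := -a 3) (by linear_combination e0)
    obtain ⟨s, hs0, hs1⟩ := H.koszul (a 0) (a 1) (by linear_combination -e4)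
    have hst : s = t := by
      apply mul_left_cancel₀ (mul_ne_zero H.w_ne H.v_ne)
      linear_combination e1 - w * hs0 + v * ht2
    subst hst
    refine ⟨fun _ => s, ?_⟩
    ext i
    fin_cases i <;> simp [syzMat3, Matrix.mulVec, dotProduct]
    · exact hs0
    · exact hs1
    · linear_combination -ht2
    · linear_combination -ht3
  · rintro ⟨x, rfl⟩
    ext i
    fin_cases i <;>
      simp [syzMat2, syzMat3, Matrix.mulVec, dotProduct, Fin.sum_univ_succ] <;> ring

theorem syzMat1_exact (H : RegularQuad u v z w) (hu : u ≠ 0) (a : Fin 5 → R) :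
    (syzMat1 u v z w).mulVec a = 0 ↔ ∃ x : Fin 4 → R, a = (syzMat2 u v z w).mulVec x := by
  constructor
  · intro h
    have e0 := congrFun h 0
    have e1 := congrFun h 1
    simp [syzMat1, Matrix.mulVec, dotProduct, Fin.sum_univ_succ] at e0 e1
    have h0 := congrArg H.σz (congrArg H.σw e0)
    simp [H.σw_w, H.σw_z, H.σw_u, H.σw_v, H.σz_z, H.σz_v, H.v_ne] at h0
    obtain ⟨β, hβ⟩ := H.σw_dvd (a 0)
    obtain ⟨α, hα⟩ := H.σz_dvd (H.σw (a 0))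
    rw [h0, sub_zero] at hα
    rw [hα] at hβ
    have h4 : w * (w * a 4) = u * (-(w * a 1)) + v * (-(v * a 0 + z * a 1 + w * a 2)) := by
      linear_combination e0
    obtain ⟨p, q, hpq⟩ := H.mem_of_w_mul h4
    obtain ⟨γ, δ, hγδ⟩ := H.mem_of_w_mul hpq
    have hzu : z * u * (a 1 + v * α + w * γ) = w * v * (a 3 - u * β - z * δ) := by
      linear_combination -e1 - u * v * hβ - z * w * hγδ
    obtain ⟨t, ht1, ht3⟩ := H.koszul_zu_wv hu hzu
    have ht2 : a 2 - u * α + v * β - z * γ + w * δ = -((w * u + z * v) * t) := by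
      apply mul_left_cancel₀ (mul_ne_zero H.w_ne H.v_ne)
      linear_combination e0 - v ^ 2 * hβ - w ^ 2 * hγδ - (w * u + z * v) * ht1
    refine ⟨![-γ, -δ, t * w - α, -(t * z) - β], ?_⟩
    ext i
    fin_cases i <;> simp [syzMat2, Matrix.mulVec, dotProduct, Fin.sum_univ_succ]
    · linear_combination hβ
    · linear_combination ht1
    · linear_combination ht2
    · linear_combination ht3
    · linear_combination hγδ
  · rintro ⟨x, rfl⟩
    ext i
    fin_cases i <;>
      simp [syzMat2, syzMat1, Matrix.mulVec, dotProduct, Fin.sum_univ_succ] <;> ring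

theorem syz_iff (H : RegularQuad u v z w) (A : Fin 3 → R) :
    A 0 * (z * u) + A 1 * (w * u + z * v) + A 2 * (w * v) = 0 ↔
      ∃ x : Fin 5 → R, A = (syzMat1 u v z w).mulVec x := by
  constructor
  · intro h
    obtain ⟨B, hB1, hB2⟩ := H.koszul_zw (a := A 0 * u + A 1 * v) (b := A 1 * u + A 2 * v)
      (by linear_combination h)
    obtain ⟨b₁, b₂, hb⟩ := H.mem_of_w_mul (b := B) (p := A 0) (q := A 1)
      (by linear_combination -hB1)
    obtain ⟨t, ht0, ht1⟩ := H.koszul (A 0 - w * b₁) (A 1 - w * b₂)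
      (by linear_combination hB1 + w * hb)
    obtain ⟨s, hs1, hs2⟩ := H.koszul (w * b₂ - u * t + z * b₁) (A 2 + z * b₂)
      (by linear_combination hB2 - z * hb - u * ht1)
    obtain ⟨c, d₁, d₂, e₁, e₂, hd, he⟩ := H.koszul_zw_mod (b₁ := b₁) (b₂ := b₂) (t := t) (s := s)
      (by linear_combination hs1)
    obtain ⟨f, hf1, hf2⟩ := H.koszul (z * d₁ + w * e₁ - t) (z * d₂ + w * e₂ - s)
      (by linear_combination hs1 - z * hd - w * he)
    refine ⟨![-f, d₁, d₂ + e₁, e₂, c], ?_⟩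
    ext i
    fin_cases i <;> simp [syzMat1, Matrix.mulVec, dotProduct, Fin.sum_univ_succ]
    · linear_combination ht0 + w * hd - v * hf1
    · linear_combination ht1 + w * he + u * hf1
    · linear_combination hs2 - z * he + u * hf2
  · rintro ⟨x, rfl⟩
    simp [syzMat1, Matrix.mulVec, dotProduct, Fin.sum_univ_succ]
    ring

end RegularQuad

end Abstract

section NormalForm

open Matrix

variable {k : Type*} [Field k]

/-- The binary quadratic form with coefficient vector `e`, as a function. -/
def quadVal (e : Fin 3 → k) (x y : k) : k := e 0 * x ^ 2 + e 1 * (x * y) + e 2 * y ^ 2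

theorem vecMul_apply_three (c : Fin 3 → k) (a : Matrix (Fin 3) (Fin 3) k) (j : Fin 3) :
    (c ᵥ* a) j = c 0 * a 0 j + c 1 * a 1 j + c 2 * a 2 j := by
  simp [Matrix.vecMul, vec3_dotProduct]

theorem quadVal_vecMul (c : Fin 3 → k) (a : Matrix (Fin 3) (Fin 3) k) (x y : k) :
    quadVal (c ᵥ* a) x y =
      c 0 * quadVal (a 0) x y + c 1 * quadVal (a 1) x y + c 2 * quadVal (a 2) x y := by
  simp only [quadVal, vecMul_apply_three]
  ring

theorem exists_root_quartic [IsAlgClosed k] (e₀ e₁ e₂ e₃ e₄ : k) :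
    ∃ x y : k, (x, y) ≠ (0, 0) ∧
      e₀ * x ^ 4 + e₁ * x ^ 3 * y + e₂ * x ^ 2 * y ^ 2 + e₃ * x * y ^ 3 + e₄ * y ^ 4 = 0 := by
  by_cases h : e₀ = 0
  · exact ⟨1, 0, by simp, by simp [h]⟩
  · let p : Polynomial k := .C e₀ * .X ^ 4 + .C e₁ * .X ^ 3 + .C e₂ * .X ^ 2 + .C e₃ * .X + .C e₄
    have hp : p.degree = 4 := by
      simp only [p]
      compute_degree!
    obtain ⟨x, hx⟩ := IsAlgClosed.exists_root p (by rw [hp]; norm_num)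
    refine ⟨x, 1, by simp, ?_⟩
    simpa [p, Polynomial.IsRoot] using hx

theorem exists_root_quadVal [IsAlgClosed k] (e : Fin 3 → k) :
    ∃ x y : k, (x, y) ≠ (0, 0) ∧ quadVal e x y = 0 := by
  obtain ⟨x, y, hxy, h⟩ := exists_root_quartic (e 0 ^ 2) (2 * e 0 * e 1)
    (e 1 ^ 2 + 2 * e 0 * e 2) (2 * e 1 * e 2) (e 2 ^ 2)
  refine ⟨x, y, hxy, pow_eq_zero_iff (two_ne_zero) |>.mp ?_⟩
  rw [quadVal]
  linear_combination h

/-- A vector orthogonal to two independent vectors of `k³` is a multiple of their cross product. -/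
theorem exists_eq_mul_crossProduct {c c' : Fin 3 → k} (hn : crossProduct c c' ≠ 0)
    {α : Fin 3 → k} (h : c 0 * α 0 + c 1 * α 1 + c 2 * α 2 = 0)
    (h' : c' 0 * α 0 + c' 1 * α 1 + c' 2 * α 2 = 0) :
    ∃ s, ∀ i, α i = s * crossProduct c c' i := by
  obtain ⟨j, hj⟩ := Function.ne_iff.mp hn
  simp only [Pi.zero_apply] at hj
  have key : ∀ i, crossProduct c c' j * α i = α j * crossProduct c c' i := by
    intro i
    fin_cases i <;> fin_cases j <;> simp [cross_apply]
    · ring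
    · linear_combination -c' 2 * h + c 2 * h'
    · linear_combination c' 1 * h - c 1 * h'
    · linear_combination c' 2 * h - c 2 * h'
    · ring
    · linear_combination -c' 0 * h + c 0 * h'
    · linear_combination -c' 1 * h + c 1 * h'
    · linear_combination c' 0 * h - c 0 * h'
    · ring
  exact ⟨α j / crossProduct c c' j, fun i => by rw [div_mul_eq_mul_div, ← key i]; field_simp⟩

theorem crossProduct_apply_eq (α β : Fin 3 → k) (j : Fin 3) :
    crossProduct α β j = α (j + 1) * β (j + 2) - α (j + 2) * β (j + 1) := by
  fin_cases j <;> simp [cross_apply]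

theorem mul_eq_mul_of_crossProduct_eq_zero {α β : Fin 3 → k} (h : crossProduct α β = 0)
    (p q : Fin 3) : α p * β q = α q * β p := by
  have h0 := congrFun h 0
  have h1 := congrFun h 1
  have h2 := congrFun h 2
  simp only [cross_apply, Pi.zero_apply, cons_val] at h0 h1 h2
  fin_cases p <;> fin_cases q <;> first | rfl | grind

/-- The forms `z · a i + w · b i` of bidegree `(2, 1)`, where the rows `a i`, `b i` are
coefficient vectors of binary quadratic forms, have no common zero on `ℙ¹ × ℙ¹`. -/
def RowsNoCommonZero (a b : Matrix (Fin 3) (Fin 3) k) : Prop :=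
  ∀ x y c d : k, (x, y) ≠ (0, 0) → (c, d) ≠ (0, 0) →
    ∃ i, c * quadVal (a i) x y + d * quadVal (b i) x y ≠ 0

namespace RowsNoCommonZero

variable {a b : Matrix (Fin 3) (Fin 3) k}

theorem exists_minor_ne (H : RowsNoCommonZero a b) {x y : k} (hxy : (x, y) ≠ (0, 0)) :
    ∃ i j, quadVal (a i) x y * quadVal (b j) x y ≠ quadVal (a j) x y * quadVal (b i) x y := by
  by_contra! h
  by_cases h0 : ∀ j, (quadVal (b j) x y, -quadVal (a j) x y) = (0, 0)
  · obtain ⟨i, hi⟩ := H x y 1 0 hxy (by simp)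
    have := h0 i
    simp only [Prod.mk.injEq, neg_eq_zero] at this
    simp [this] at hi
  · obtain ⟨j, hj⟩ := not_forall.mp h0
    obtain ⟨i, hi⟩ := H x y _ _ hxy hj
    exact hi (by linear_combination h i j)

theorem not_rank_one [IsAlgClosed k] (H : RowsNoCommonZero a b) {c d : k}
    (hcd : (c, d) ≠ (0, 0)) (e h : Fin 3 → k) : ¬ ∀ i j, c * a i j + d * b i j = e i * h j := by
  intro hM
  obtain ⟨x, y, hxy, hr⟩ := exists_root_quadVal h
  obtain ⟨i, hi⟩ := H x y c d hxy hcd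
  apply hi
  simp only [quadVal] at hr ⊢
  linear_combination x ^ 2 * hM i 0 + x * y * hM i 1 + y ^ 2 * hM i 2 + e i * hr

theorem crossProduct_eq_zero_of_root (H : RowsNoCommonZero a b) {c c' : Fin 3 → k} {x y : k}
    (hxy : (x, y) ≠ (0, 0)) (h1 : quadVal (c ᵥ* a) x y = 0) (h2 : quadVal (c ᵥ* b) x y = 0)
    (h3 : quadVal (c' ᵥ* a) x y = 0) (h4 : quadVal (c' ᵥ* b) x y = 0) :
    crossProduct c c' = 0 := by
  by_contra hn
  rw [quadVal_vecMul] at h1 h2 h3 h4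
  obtain ⟨s, hs⟩ := exists_eq_mul_crossProduct hn (α := fun i => quadVal (a i) x y) h1 h3
  obtain ⟨t, ht⟩ := exists_eq_mul_crossProduct hn (α := fun i => quadVal (b i) x y) h2 h4
  obtain ⟨i, j, hij⟩ := H.exists_minor_ne hxy
  have e1 : quadVal (a i) x y = _ := hs i
  have e2 : quadVal (a j) x y = _ := hs j
  have e3 : quadVal (b i) x y = _ := ht i
  have e4 : quadVal (b j) x y = _ := ht j
  exact hij (by rw [e1, e2, e3, e4]; ring)

theorem crossProduct_eq_zero_of_pencil [IsAlgClosed k] (H : RowsNoCommonZero a b)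
    {c c' : Fin 3 → k} {s t : k} (hst : (s, t) ≠ (0, 0))
    (h : s • (c ᵥ* a) + t • (c ᵥ* b) = 0) (h' : s • (c' ᵥ* a) + t • (c' ᵥ* b) = 0) :
    crossProduct c c' = 0 := by
  by_contra hn
  have key : ∀ j, ∃ m, ∀ i, s * a i j + t * b i j = m * crossProduct c c' i := by
    intro j
    have hj := congrFun h j
    have hj' := congrFun h' j
    simp only [Pi.add_apply, Pi.smul_apply, smul_eq_mul, vecMul_apply_three, Pi.zero_apply]
      at hj hj'
    exact exists_eq_mul_crossProduct hn (α := fun i => s * a i j + t * b i j)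
      (by linear_combination hj) (by linear_combination hj')
  choose m hm using key
  exact H.not_rank_one hst (crossProduct c c') m fun i j => by rw [hm j i]; ring

theorem eq_zero_of_vecMul [IsAlgClosed k] (H : RowsNoCommonZero a b) {c : Fin 3 → k}
    (ha : c ᵥ* a = 0) (hb : c ᵥ* b = 0) : c = 0 := by
  by_contra hc
  obtain ⟨j, hj⟩ := Function.ne_iff.mp hc
  simp only [Pi.zero_apply] at hj
  have hα : ∀ x y, c 0 * quadVal (a 0) x y + c 1 * quadVal (a 1) x y
      + c 2 * quadVal (a 2) x y = 0 := fun x y => by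
    rw [← quadVal_vecMul, ha]; simp [quadVal]
  have hβ : ∀ x y, c 0 * quadVal (b 0) x y + c 1 * quadVal (b 1) x y
      + c 2 * quadVal (b 2) x y = 0 := fun x y => by
    rw [← quadVal_vecMul, hb]; simp [quadVal]
  have hroot : ∀ p q : Fin 3, ∃ x y, (x, y) ≠ ((0 : k), (0 : k)) ∧
      quadVal (a p) x y * quadVal (b q) x y - quadVal (a q) x y * quadVal (b p) x y = 0 := by
    intro p q
    obtain ⟨x, y, hxy, h⟩ := exists_root_quartic
      (a p 0 * b q 0 - a q 0 * b p 0)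
      (a p 0 * b q 1 + a p 1 * b q 0 - a q 0 * b p 1 - a q 1 * b p 0)
      (a p 0 * b q 2 + a p 1 * b q 1 + a p 2 * b q 0
        - a q 0 * b p 2 - a q 1 * b p 1 - a q 2 * b p 0)
      (a p 1 * b q 2 + a p 2 * b q 1 - a q 1 * b p 2 - a q 2 * b p 1)
      (a p 2 * b q 2 - a q 2 * b p 2)
    exact ⟨x, y, hxy, by simp only [quadVal]; linear_combination h⟩
  obtain ⟨x, y, hxy, hr⟩ := hroot (j + 1) (j + 2)
  obtain ⟨p, q, hpq⟩ := H.exists_minor_ne hxy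
  have hn : crossProduct (fun i => quadVal (a i) x y) (fun i => quadVal (b i) x y) ≠ 0 :=
    fun h0 => hpq (mul_eq_mul_of_crossProduct_eq_zero h0 p q)
  obtain ⟨s, hs⟩ := exists_eq_mul_crossProduct hn (α := c)
    (by linear_combination hα x y) (by linear_combination hβ x y)
  apply hj
  rw [hs j, crossProduct_apply_eq]
  exact mul_eq_zero_of_right _ hr

end RowsNoCommonZero

/-- The scalar triple product. -/
def tripleProd (p q r : Fin 3 → k) : k :=
  p 0 * (q 1 * r 2 - q 2 * r 1) + p 1 * (q 2 * r 0 - q 0 * r 2) + p 2 * (q 0 * r 1 - q 1 * r 0)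

/-- The coefficients of the polynomial `det (a - X b)`, up to sign. -/
def pencilCoeff (a b : Matrix (Fin 3) (Fin 3) k) : Fin 4 → k :=
  ![tripleProd (aᵀ 0) (aᵀ 1) (aᵀ 2),
    tripleProd (bᵀ 0) (aᵀ 1) (aᵀ 2) + tripleProd (aᵀ 0) (bᵀ 1) (aᵀ 2)
      + tripleProd (aᵀ 0) (aᵀ 1) (bᵀ 2),
    tripleProd (aᵀ 0) (bᵀ 1) (bᵀ 2) + tripleProd (bᵀ 0) (aᵀ 1) (bᵀ 2)
      + tripleProd (bᵀ 0) (bᵀ 1) (aᵀ 2),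
    tripleProd (bᵀ 0) (bᵀ 1) (bᵀ 2)]

theorem det_sub_smul (a b : Matrix (Fin 3) (Fin 3) k) (r : k) :
    (a - r • b).det = pencilCoeff a b 0 - pencilCoeff a b 1 * r + pencilCoeff a b 2 * r ^ 2
      - pencilCoeff a b 3 * r ^ 3 := by
  simp [det_fin_three, pencilCoeff, tripleProd]
  ring

/-- A singular pencil whose first matrix has rank two has a quadratic family of left kernel
vectors. -/
theorem exists_kernel_of_pencilCoeff (a b : Matrix (Fin 3) (Fin 3) k) (h : pencilCoeff a b = 0)
    {j : Fin 3} (hj : crossProduct (aᵀ (j + 1)) (aᵀ (j + 2)) ≠ 0) :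
    ∃ c₀ c₁ c₂ : Fin 3 → k, c₂ ≠ 0 ∧ c₀ ᵥ* b = 0 ∧ c₀ ᵥ* a = c₁ ᵥ* b ∧ c₁ ᵥ* a = c₂ ᵥ* b ∧
      c₂ ᵥ* a = 0 := by
  have h0 := congrFun h 0
  have h1 := congrFun h 1
  have h2 := congrFun h 2
  have h3 := congrFun h 3
  simp only [pencilCoeff, tripleProd, transpose_apply, cons_val, Pi.zero_apply] at h0 h1 h2 h3
  refine ⟨crossProduct (bᵀ (j + 1)) (bᵀ (j + 2)),
    -(crossProduct (bᵀ (j + 1)) (aᵀ (j + 2)) + crossProduct (aᵀ (j + 1)) (bᵀ (j + 2))),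
    crossProduct (aᵀ (j + 1)) (aᵀ (j + 2)), hj, ?_, ?_, ?_, ?_⟩ <;> ext m <;>
    rw [vecMul_apply_three] <;> try rw [vecMul_apply_three]
  all_goals
    fin_cases j <;> fin_cases m <;> simp [cross_apply] <;>
    first
    | ring1
    | linear_combination h0
    | linear_combination -h1
    | linear_combination h2
    | linear_combination h3

/-- No common roots for two binary quadratic forms. -/
def NoCommonRoot (u v : Fin 3 → k) : Prop :=
  ∀ x y, (x, y) ≠ (0, 0) → quadVal u x y = 0 → quadVal v x y ≠ 0

theorem NoCommonRoot.eq_zero [IsAlgClosed k] {u v : Fin 3 → k} (h : NoCommonRoot u v) {s t : k}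
    (hst : s • u + t • v = 0) : s = 0 ∧ t = 0 := by
  have hval : ∀ x y, s * quadVal u x y + t * quadVal v x y = 0 := fun x y => by
    have e0 := congrFun hst 0
    have e1 := congrFun hst 1
    have e2 := congrFun hst 2
    simp only [Pi.add_apply, Pi.smul_apply, smul_eq_mul, Pi.zero_apply] at e0 e1 e2
    simp only [quadVal]
    linear_combination x ^ 2 * e0 + x * y * e1 + y ^ 2 * e2
  obtain ⟨x, y, hxy, hu⟩ := exists_root_quadVal u
  obtain ⟨x', y', hxy', hv⟩ := exists_root_quadVal v
  have hu' := hval x y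
  have hv' := hval x' y'
  rw [hu, mul_zero, zero_add, mul_eq_zero] at hu'
  rw [hv, mul_zero, add_zero, mul_eq_zero] at hv'
  exact ⟨hv'.resolve_right fun h0 => h x' y' hxy' h0 hv, hu'.resolve_right (h x y hxy hu)⟩

theorem RowsNoCommonZero.exists_normal_form [IsAlgClosed k] {a b : Matrix (Fin 3) (Fin 3) k}
    (H : RowsNoCommonZero a b) (hd : pencilCoeff a b = 0) :
    ∃ (c : Matrix (Fin 3) (Fin 3) k) (u v : Fin 3 → k), c.det ≠ 0 ∧ NoCommonRoot u v ∧
      c 0 ᵥ* a = u ∧ c 0 ᵥ* b = 0 ∧ c 1 ᵥ* a = v ∧ c 1 ᵥ* b = u ∧ c 2 ᵥ* a = 0 ∧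
      c 2 ᵥ* b = v := by
  obtain ⟨j, hj⟩ : ∃ j : Fin 3, crossProduct (aᵀ (j + 1)) (aᵀ (j + 2)) ≠ 0 := by
    by_contra! h
    have hm : ∀ p q i j, a p i * a q j = a q i * a p j := by
      intro p q i j
      have h0 := mul_eq_mul_of_crossProduct_eq_zero (h 0) p q
      have h1 := mul_eq_mul_of_crossProduct_eq_zero (h 1) p q
      have h2 := mul_eq_mul_of_crossProduct_eq_zero (h 2) p q
      simp only [transpose_apply, Fin.reduceAdd] at h0 h1 h2
      fin_cases i <;> fin_cases j <;> first | exact mul_comm _ _ | grind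
    by_cases ha : a = 0
    · exact H.not_rank_one (c := 1) (d := 0) (by simp) 0 0 (by simp [ha])
    · obtain ⟨p, hp⟩ := Function.ne_iff.mp ha
      obtain ⟨q, hq⟩ := Function.ne_iff.mp hp
      have hq : a p q ≠ 0 := hq
      refine H.not_rank_one (c := 1) (d := 0) (by simp) (fun i => a i q)
        (fun j => a p j / a p q) fun i j => ?_
      rw [mul_div_assoc', hm]
      field_simp
      ring
  obtain ⟨c₀, c₁, c₂, hc, e0, e1, e2, e3⟩ := exists_kernel_of_pencilCoeff a b hd hj
  have hv : c₁ ᵥ* a ≠ 0 := fun h0 => hc (H.eq_zero_of_vecMul e3 (e2.symm.trans h0))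
  have hn : crossProduct c₁ c₂ ≠ 0 := by
    intro h0
    apply hv
    obtain ⟨i, hi⟩ := Function.ne_iff.mp hc
    have hi : c₂ i ≠ 0 := hi
    have hprop : c₁ = (c₁ i / c₂ i) • c₂ := by
      ext m
      rw [Pi.smul_apply, smul_eq_mul, div_mul_eq_mul_div, eq_div_iff hi]
      exact mul_eq_mul_of_crossProduct_eq_zero h0 m i
    rw [hprop, smul_vecMul, e3, smul_zero]
  have huv : NoCommonRoot (c₀ ᵥ* a) (c₁ ᵥ* a) := by
    intro x y hxy hu hv
    exact hn (H.crossProduct_eq_zero_of_root hxy hv (e1 ▸ hu) (by rw [e3]; simp [quadVal])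
      (e2 ▸ hv))
  refine ⟨of ![c₀, c₁, c₂], _, _, fun hdet => ?_, huv, rfl, e0, rfl, e1.symm, e3, e2.symm⟩
  obtain ⟨m, hm, hm'⟩ := exists_vecMul_eq_zero_iff.mpr hdet
  have hcomb : m 0 • c₀ + m 1 • c₁ + m 2 • c₂ = 0 := by
    rw [← hm']
    ext i
    simp [vecMul_apply_three]
  have ha := congrArg (· ᵥ* a) hcomb
  have hb := congrArg (· ᵥ* b) hcomb
  simp only [add_vecMul, smul_vecMul, e0, e3, smul_zero, add_zero, zero_add, zero_vecMul,
    ← e1, ← e2] at ha hb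
  obtain ⟨m0, m1⟩ := huv.eq_zero ha
  obtain ⟨-, m2⟩ := huv.eq_zero hb
  apply hm
  ext i
  fin_cases i <;> assumption

end NormalForm

section Bihomogeneous

variable {k : Type*} [Field k] {p q : Rk k} {m n m' n' M N : ℤ}

theorem bihom_zero (m n : ℤ) : Bihom (0 : Rk k) m n :=
  isWeightedHomogeneous_zero k bidegWt (m, n)

theorem Bihom.neg (hp : Bihom p m n) : Bihom (-p) m n :=
  IsWeightedHomogeneous.neg hp

theorem Bihom.add (hp : Bihom p m n) (hq : Bihom q m n) : Bihom (p + q) m n :=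
  IsWeightedHomogeneous.add hp hq

theorem Bihom.mul (hp : Bihom p m n) (hq : Bihom q m' n') (hM : m + m' = M) (hN : n + n' = N) :
    Bihom (p * q) M N := by
  subst hM hN
  exact IsWeightedHomogeneous.mul hp hq

theorem Bihom.C_mul (hp : Bihom p m n) (r : k) : Bihom (C r * p) m n :=
  IsWeightedHomogeneous.C_mul hp r

theorem bihom_X (i : Fin 4) : Bihom (X i : Rk k) (bidegWt i).1 (bidegWt i).2 :=
  isWeightedHomogeneous_X k bidegWt i

theorem Bihom.induction {P : Rk k → Prop} (hp : Bihom p m n) (zero : P 0)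
    (add : ∀ f g, P f → P g → P (f + g))
    (monomial : ∀ (i j i' j' : ℕ) (r : k), (i : ℤ) + j = m → (i' : ℤ) + j' = n →
      P (C r * (X 0 ^ i * X 1 ^ j * X 2 ^ i' * X 3 ^ j'))) : P p := by
  rw [p.as_sum]
  refine Finset.sum_induction _ P add zero fun d hd => ?_
  have hw := hp (mem_support_iff.mp hd)
  rw [Finsupp.weight_apply, Finsupp.sum_fintype _ _ (by simp)] at hw
  have h₁ := congrArg Prod.fst hw
  have h₂ := congrArg Prod.snd hw
  simp [Fin.sum_univ_four, bidegWt] at h₁ h₂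
  have := monomial (d 0) (d 1) (d 2) (d 3) (coeff d p) h₁ h₂
  rwa [MvPolynomial.monomial_eq, Finsupp.prod_fintype _ _ (by simp), Fin.prod_univ_four]

/-- The binary quadratic form in `x, y` with coefficient vector `e`. -/
def quadPoly (e : Fin 3 → k) : Rk k :=
  C (e 0) * X 0 ^ 2 + C (e 1) * (X 0 * X 1) + C (e 2) * X 1 ^ 2

/-- The form `z e + w f` of bidegree `(2, 1)`, for binary quadratic forms `e`, `f`. -/
def biForm (e f : Fin 3 → k) : Rk k := X 2 * quadPoly e + X 3 * quadPoly f

@[simp]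
theorem eval_quadPoly (e : Fin 3 → k) (x y c d : k) :
    eval ![x, y, c, d] (quadPoly e) = quadVal e x y := by
  simp [quadPoly, quadVal]

@[simp]
theorem eval_biForm (e f : Fin 3 → k) (x y c d : k) :
    eval ![x, y, c, d] (biForm e f) = c * quadVal e x y + d * quadVal f x y := by
  simp [biForm]

theorem bihom_quadPoly (e : Fin 3 → k) : Bihom (quadPoly e) 2 0 := by
  have h0 := bihom_X (k := k) 0
  have h1 := bihom_X (k := k) 1
  simp only [quadPoly, pow_two]
  exact (((h0.mul h0 rfl rfl).C_mul _).add ((h0.mul h1 rfl rfl).C_mul _)).add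
    ((h1.mul h1 rfl rfl).C_mul _)

theorem Bihom.exists_biForm (hp : Bihom p 2 1) : ∃ e f, p = biForm e f := by
  refine hp.induction (P := fun p => ∃ e f, p = biForm e f) ⟨0, 0, by simp [biForm, quadPoly]⟩ ?_ ?_
  · rintro _ _ ⟨e, f, rfl⟩ ⟨e', f', rfl⟩
    exact ⟨e + e', f + f', by simp [biForm, quadPoly]; ring⟩
  · intro i j i' j' r hi hi'
    obtain rfl : j = 2 - i := by omega
    obtain rfl : j' = 1 - i' := by omega
    have hi2 : i ≤ 2 := by omega
    have hi1 : i' ≤ 1 := by omega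
    interval_cases i' <;> interval_cases i
    · exact ⟨0, ![0, 0, r], by simp [biForm, quadPoly]; ring⟩
    · exact ⟨0, ![0, r, 0], by simp [biForm, quadPoly]; ring⟩
    · exact ⟨0, ![r, 0, 0], by simp [biForm, quadPoly]; ring⟩
    · exact ⟨![0, 0, r], 0, by simp [biForm, quadPoly]; ring⟩
    · exact ⟨![0, r, 0], 0, by simp [biForm, quadPoly]; ring⟩
    · exact ⟨![r, 0, 0], 0, by simp [biForm, quadPoly]; ring⟩

theorem Bihom.exists_quadPoly (hp : Bihom p 2 0) : ∃ e, p = quadPoly e := by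
  refine hp.induction (P := fun p => ∃ e, p = quadPoly e) ⟨0, by simp [quadPoly]⟩ ?_ ?_
  · rintro _ _ ⟨e, rfl⟩ ⟨e', rfl⟩
    exact ⟨e + e', by simp [quadPoly]; ring⟩
  · intro i j i' j' r hi hi'
    obtain rfl : j = 2 - i := by omega
    obtain rfl : i' = 0 := by omega
    obtain rfl : j' = 0 := by omega
    have hi2 : i ≤ 2 := by omega
    interval_cases i
    · exact ⟨![0, 0, r], by simp [quadPoly]⟩
    · exact ⟨![0, r, 0], by simp [quadPoly]⟩
    · exact ⟨![r, 0, 0], by simp [quadPoly]⟩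

theorem Bihom.exists_linear (hp : Bihom p 0 1) : ∃ s t : k, p = C s * X 2 + C t * X 3 := by
  refine hp.induction (P := fun p => ∃ s t : k, p = C s * X 2 + C t * X 3) ⟨0, 0, by simp⟩ ?_ ?_
  · rintro _ _ ⟨s, t, rfl⟩ ⟨s', t', rfl⟩
    exact ⟨s + s', t + t', by simp; ring⟩
  · intro i j i' j' r hi hi'
    obtain rfl : j' = 1 - i' := by omega
    obtain rfl : i = 0 := by omega
    obtain rfl : j = 0 := by omega
    have hi1 : i' ≤ 1 := by omega
    interval_cases i'
    · exact ⟨0, r, by simp⟩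
    · exact ⟨r, 0, by simp⟩

theorem quadVal_injective {e e' : Fin 3 → k} (h : ∀ x y, quadVal e x y = quadVal e' x y) :
    e = e' := by
  have h0 := h 1 0
  have h1 := h 1 1
  have h2 := h 0 1
  simp [quadVal] at h0 h1 h2
  ext i
  fin_cases i
  · exact h0
  · show e 1 = e' 1
    linear_combination h1 - h0 - h2
  · exact h2

theorem biForm_injective {e f e' f' : Fin 3 → k} (h : biForm e f = biForm e' f') :
    e = e' ∧ f = f' := by
  have key := fun x y c d => congrArg (eval ![x, y, c, d]) h
  simp only [eval_biForm] at key
  exact ⟨quadVal_injective fun x y => by simpa using key x y 1 0,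
    quadVal_injective fun x y => by simpa using key x y 0 1⟩

theorem quadPoly_mul_linear (e : Fin 3 → k) (s t : k) :
    quadPoly e * (C s * X 2 + C t * X 3) = biForm (s • e) (t • e) := by
  simp [biForm, quadPoly]
  ring

theorem combination_biForm (c : Fin 3 → k) (a b : Matrix (Fin 3) (Fin 3) k) :
    C (c 0) * biForm (a 0) (b 0) + C (c 1) * biForm (a 1) (b 1) + C (c 2) * biForm (a 2) (b 2) =
      biForm (Matrix.vecMul c a) (Matrix.vecMul c b) := by
  simp [biForm, quadPoly, vecMul_apply_three]
  ring

/-- The linear form `α x + β y`. -/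
def linPoly (α β : k) : Rk k := C α * X 0 + C β * X 1

theorem dvd_sub_algHom {σ : Type*} (l : MvPolynomial σ k)
    (τ : MvPolynomial σ k →ₐ[k] MvPolynomial σ k) (h : ∀ i, l ∣ X i - τ (X i))
    (f : MvPolynomial σ k) : l ∣ f - τ f := by
  have key : Ideal.Quotient.mkₐ k (Ideal.span {l}) =
      (Ideal.Quotient.mkₐ k (Ideal.span {l})).comp τ :=
    MvPolynomial.algHom_ext fun i => by
      simpa [Ideal.Quotient.eq, Ideal.mem_span_singleton] using h i
  have := DFunLike.congr_fun key f
  simpa [Ideal.Quotient.eq, Ideal.mem_span_singleton] using this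

theorem linPoly_dvd_of_dvd_mul {α β : k} {v : Fin 3 → k} (hαβ : (α, β) ≠ (0, 0))
    (hv : quadVal v β (-α) ≠ 0) {g : Rk k} (h : linPoly α β ∣ quadPoly v * g) :
    linPoly α β ∣ g := by
  obtain ⟨r, s, hrs⟩ : ∃ r s : k, α * r + β * s = 1 := by
    by_cases hα : α = 0
    · have hβ : β ≠ 0 := fun hβ => hαβ (by rw [hα, hβ])
      exact ⟨0, β⁻¹, by field_simp; ring⟩
    · exact ⟨α⁻¹, 0, by field_simp; ring⟩
  have hC : C α * C r + C β * C s = (1 : Rk k) := by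
    rw [← C_mul, ← C_mul, ← C_add, hrs, C_1]
  let m : Rk k := C s * X 0 - C r * X 1
  let τ : Rk k →ₐ[k] Rk k := aeval ![C β * m, -(C α * m), X 2, X 3]
  have hτ : ∀ f, linPoly α β ∣ f - τ f := by
    refine dvd_sub_algHom _ τ fun i => ?_
    fin_cases i <;> simp [τ, m, linPoly]
    · exact ⟨C r, by linear_combination -(X 0) * hC⟩
    · exact ⟨C s, by linear_combination -(X 1) * hC⟩
  have hl : τ (linPoly α β) = 0 := by
    simp [τ, linPoly, MvPolynomial.algebraMap_eq]
    ring
  have hv' : τ (quadPoly v) = C (quadVal v β (-α)) * m ^ 2 := by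
    simp [τ, quadPoly, quadVal, MvPolynomial.algebraMap_eq]
    ring
  have hm : m ≠ 0 := by
    intro hm
    have := congrArg (eval ![β, -α, 0, 0]) hm
    simp [m] at this
    exact one_ne_zero (α := k) (by linear_combination this - hrs)
  obtain ⟨f, hf⟩ := h
  have hg : τ g = 0 := by
    have := congrArg τ hf
    rw [map_mul, map_mul, hl, zero_mul, hv'] at this
    simpa [hv, hm] using this
  simpa [hg] using hτ g

theorem exists_quadPoly_eq_mul {u : Fin 3 → k} {x y : k} (hxy : (x, y) ≠ (0, 0))
    (h : quadVal u x y = 0) : ∃ r s, quadPoly u = linPoly y (-x) * linPoly r s := by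
  obtain ⟨r, s, h0, h1, h2⟩ : ∃ r s, u 0 = y * r ∧ u 1 = y * s - x * r ∧ u 2 = -(x * s) := by
    rw [quadVal] at h
    by_cases hy : y = 0
    · have hx : x ≠ 0 := fun hx => hxy (by rw [hx, hy])
      subst hy
      have hu : u 0 = 0 := by simpa [hx] using h
      refine ⟨-u 1 / x, -u 2 / x, by simp [hu], ?_, ?_⟩
      · field_simp
        ring
      · field_simp
    · refine ⟨u 0 / y, (u 1 + x * (u 0 / y)) / y, ?_, ?_, ?_⟩
      · field_simp
      · field_simp
        ring
      · field_simp
        linear_combination h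
  refine ⟨r, s, ?_⟩
  rw [quadPoly, h0, h1, h2]
  simp [linPoly]
  ring

/-- The retraction of `R` that kills the variable `X i`. -/
def killVar (i : Fin 4) : Rk k →ₐ[k] Rk k := aeval fun j => if j = i then 0 else X j

theorem killVar_X_self (i : Fin 4) : killVar i (X i : Rk k) = 0 := by
  simp [killVar]

theorem killVar_X_of_ne {i j : Fin 4} (h : j ≠ i) : killVar i (X j : Rk k) = X j := by
  simp [killVar, h]

theorem killVar_quadPoly {i : Fin 4} (h0 : 0 ≠ i) (h1 : 1 ≠ i) (e : Fin 3 → k) :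
    killVar i (quadPoly e) = quadPoly e := by
  simp [quadPoly, killVar_X_of_ne h0, killVar_X_of_ne h1, algHom_C, MvPolynomial.algebraMap_eq]

theorem X_dvd_sub_killVar (i : Fin 4) (f : Rk k) : X i ∣ f - killVar i f := by
  refine dvd_sub_algHom _ _ (fun j => ?_) f
  by_cases h : j = i
  · rw [h, killVar_X_self, sub_zero]
  · rw [killVar_X_of_ne h, sub_self]
    exact dvd_zero _
variable [IsAlgClosed k] {u v : Fin 3 → k}

theorem NoCommonRoot.left_ne_zero (h : NoCommonRoot u v) : quadPoly u ≠ 0 := by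
  intro hu
  obtain ⟨x, y, hxy, hv⟩ := exists_root_quadVal v
  refine h x y hxy ?_ hv
  rw [← eval_quadPoly u x y 0 0, hu, map_zero]

theorem NoCommonRoot.right_ne_zero (h : NoCommonRoot u v) : quadPoly v ≠ 0 := by
  intro hv
  obtain ⟨x, y, hxy, hu⟩ := exists_root_quadVal u
  refine h x y hxy hu ?_
  rw [← eval_quadPoly v x y 0 0, hv, map_zero]

theorem NoCommonRoot.koszul (h : NoCommonRoot u v) (a b : Rk k)
    (hab : quadPoly u * a + quadPoly v * b = 0) :
    ∃ t, a = quadPoly v * t ∧ b = -(quadPoly u * t) := by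
  obtain ⟨x, y, hxy, hu⟩ := exists_root_quadVal u
  obtain ⟨r, s, hrs⟩ := exists_quadPoly_eq_mul hxy hu
  have hne := hrs ▸ h.left_ne_zero
  have cancel : ∀ {α β : k} {g : Rk k}, linPoly α β ≠ 0 → linPoly α β ∣ quadPoly u →
      linPoly α β ∣ quadPoly v * g → linPoly α β ∣ g := by
    intro α β g h0 hd
    have hαβ : (α, β) ≠ (0, 0) := by
      rintro heq
      obtain ⟨rfl, rfl⟩ := Prod.mk.inj heq
      simp [linPoly] at h0
    refine linPoly_dvd_of_dvd_mul hαβ (h _ _ ?_ ?_)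
    · simpa [and_comm] using hαβ
    · obtain ⟨f, hf⟩ := hd
      rw [← eval_quadPoly u β (-α) 0 0, hf]
      simp [linPoly]
      left
      ring
  have h1 := left_ne_zero_of_mul hne
  have h2 := right_ne_zero_of_mul hne
  obtain ⟨b₁, hb₁⟩ := cancel h1 ⟨_, hrs⟩ (g := b)
    ⟨-(linPoly r s * a), by linear_combination hab - a * hrs⟩
  have hab' : linPoly r s * a + quadPoly v * b₁ = 0 := by
    apply mul_left_cancel₀ h1
    linear_combination hab - a * hrs - quadPoly v * hb₁
  obtain ⟨b₂, hb₂⟩ := cancel h2 ⟨_, hrs.trans (mul_comm _ _)⟩ (g := b₁)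
    ⟨-a, by linear_combination hab'⟩
  have ha : a + quadPoly v * b₂ = 0 := by
    apply mul_left_cancel₀ h2
    linear_combination hab' - quadPoly v * hb₂
  exact ⟨-b₂, by linear_combination ha, by rw [hb₁, hb₂, hrs]; ring⟩

/-- Coprime binary quadratic forms together with `z` and `w`. -/
def NoCommonRoot.regularQuad (h : NoCommonRoot u v) :
    RegularQuad (quadPoly u) (quadPoly v) (X 2) (X 3 : Rk k) where
  σz := (killVar 2 : Rk k →ₐ[k] Rk k)
  σw := (killVar 3 : Rk k →ₐ[k] Rk k)
  σz_dvd := X_dvd_sub_killVar 2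
  σw_dvd := X_dvd_sub_killVar 3
  σz_z := killVar_X_self 2
  σz_w := killVar_X_of_ne (show (3 : Fin 4) ≠ 2 by decide)
  σz_u := killVar_quadPoly (i := 2) (by decide) (by decide) u
  σz_v := killVar_quadPoly (i := 2) (by decide) (by decide) v
  σw_w := killVar_X_self 3
  σw_z := killVar_X_of_ne (show (2 : Fin 4) ≠ 3 by decide)
  σw_u := killVar_quadPoly (i := 3) (by decide) (by decide) u
  σw_v := killVar_quadPoly (i := 3) (by decide) (by decide) v
  z_ne := X_ne_zero 2
  w_ne := X_ne_zero 3
  v_ne := h.right_ne_zero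
  koszul := h.koszul

end Bihomogeneous

section Generic

open Matrix

variable {k : Type*} [Field k] [IsAlgClosed k] {a b : Matrix (Fin 3) (Fin 3) k}

theorem Projectivization.eq_of_crossProduct_eq_zero {F : Type*} [Field F]
    {P Q : Projectivization F (Fin 3 → F)} (h : crossProduct P.rep Q.rep = 0) : P = Q := by
  by_contra hne
  rw [← ne_eq, ← Projectivization.independent_pair_iff_ne, Projectivization.independent_iff] at hne
  refine crossProduct_ne_zero_iff_linearIndependent.mpr ?_ h
  have hrep : Projectivization.rep ∘ ![P, Q] = ![P.rep, Q.rep] := by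
    ext i
    fin_cases i <;> rfl
  exact hrep ▸ hne

/-- A bihomogeneous triple without common zeros which is non-generic has a singular pencil. -/
theorem RowsNoCommonZero.pencilCoeff_eq_zero (H : RowsNoCommonZero a b)
    (hgen : ¬ BidegGeneric (biForm (a 0) (b 0)) (biForm (a 1) (b 1)) (biForm (a 2) (b 2))) :
    pencilCoeff a b = 0 := by
  set S := {P : Projectivization k (Fin 3 → k) |
    ∃ q l : Rk k, Bihom q 2 0 ∧ Bihom l 0 1 ∧
      P.rep 0 • biForm (a 0) (b 0) + P.rep 1 • biForm (a 1) (b 1) +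
        P.rep 2 • biForm (a 2) (b 2) = q * l} with hS
  have hinf : S.Infinite := hgen
  let S₀ := {P : Projectivization k (Fin 3 → k) | P.rep ᵥ* b = 0}
  have hS₀ : S₀.Subsingleton := fun P hP Q hQ =>
    Projectivization.eq_of_crossProduct_eq_zero <|
      H.crossProduct_eq_zero_of_pencil (s := 0) (t := 1) (by simp)
        (by simpa using show P.rep ᵥ* b = 0 from hP)
        (by simpa using show Q.rep ᵥ* b = 0 from hQ)
  have hdiff : (S \ S₀).Infinite := hinf.sdiff hS₀.finite
  have hr : ∀ P ∈ S \ S₀, ∃ r : k, P.rep ᵥ* a = r • (P.rep ᵥ* b) := by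
    rintro P ⟨⟨q, l, hq, hl, h⟩, hP⟩
    obtain ⟨e, rfl⟩ := hq.exists_quadPoly
    obtain ⟨s, t, rfl⟩ := hl.exists_linear
    simp only [smul_eq_C_mul] at h
    rw [combination_biForm, quadPoly_mul_linear] at h
    obtain ⟨ha, hb⟩ := biForm_injective h
    have ht : t ≠ 0 := fun ht => hP (show P.rep ᵥ* b = 0 by simpa [ht] using hb)
    exact ⟨s / t, by rw [ha, hb, smul_smul, div_mul_cancel₀ _ ht]⟩
  choose! r hr using hr
  have hinj : Set.InjOn r (S \ S₀) := fun P hP Q hQ hPQ =>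
    Projectivization.eq_of_crossProduct_eq_zero <|
      H.crossProduct_eq_zero_of_pencil (s := 1) (t := -r P) (by simp)
        (by rw [hr P hP]; simp) (by rw [hr Q hQ, hPQ]; simp)
  let d := pencilCoeff a b
  let f : Polynomial k := Polynomial.C (d 0) - Polynomial.C (d 1) * Polynomial.X +
    Polynomial.C (d 2) * Polynomial.X ^ 2 - Polynomial.C (d 3) * Polynomial.X ^ 3
  have hf : f = 0 := by
    refine Polynomial.eq_zero_of_infinite_isRoot f ((hdiff.image hinj).mono ?_)
    rintro _ ⟨P, hP, rfl⟩
    have hdet : (a - r P • b).det = 0 :=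
      Matrix.exists_vecMul_eq_zero_iff.mp ⟨P.rep, P.rep_nonzero, by
        rw [Matrix.vecMul_sub, Matrix.vecMul_smul, hr P hP, sub_self]⟩
    rw [det_sub_smul] at hdet
    simpa [f, d, Polynomial.IsRoot] using hdet
  have hc := fun n => congrArg (Polynomial.coeff · n) hf
  simp only [f, Polynomial.coeff_sub, Polynomial.coeff_add, Polynomial.coeff_C,
    Polynomial.coeff_C_mul, Polynomial.coeff_X, Polynomial.coeff_X_pow, Polynomial.coeff_zero] at hc
  funext i
  fin_cases i
  · simpa using hc 0
  · simpa using hc 1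
  · simpa using hc 2
  · simpa using hc 3

end Generic

section Resolution

variable {k : Type*} [Field k] {u v z w : Rk k}

theorem bihom_syzMat1 (hu : Bihom u 2 0) (hv : Bihom v 2 0) (hz : Bihom z 0 1) (hw : Bihom w 0 1)
    (i : Fin 3) (j : Fin 5) :
    Bihom (syzMat1 u v z w i j) ((ngColDeg1 j).1 - 2) ((ngColDeg1 j).2 - 1) := by
  have hs : Bihom (w * u + z * v) 2 1 :=
    (hw.mul hu (by norm_num) (by norm_num)).add (hz.mul hv (by norm_num) (by norm_num))
  have hs' : Bihom (-(z * v) + -(w * u)) 2 1 := by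
    rw [← neg_add_rev]
    exact hs.neg
  have hmul : ∀ {p q : Rk k} {m n m' n' M N : ℤ}, m + m' = M → n + n' = N → Bihom p m n →
      Bihom q m' n' → Bihom (p * q) M N := fun hM hN hp hq => hp.mul hq hM hN
  have huu := hmul (M := 4) (N := 0) rfl rfl hu hu
  have huv := hmul (M := 4) (N := 0) rfl rfl hu hv
  have hvv := hmul (M := 4) (N := 0) rfl rfl hv hv
  have hzz := hmul (M := 0) (N := 2) rfl rfl hz hz
  have hzw := hmul (M := 0) (N := 2) rfl rfl hz hw
  have hww := hmul (M := 0) (N := 2) rfl rfl hw hw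
  have hzu := hmul (M := 2) (N := 1) rfl rfl hz hu
  have hwv := hmul (M := 2) (N := 1) rfl rfl hw hv
  fin_cases i <;> fin_cases j <;> simp [syzMat1, ngColDeg1, pow_two] <;>
  first
  | exact bihom_zero _ _
  | assumption
  | (apply Bihom.neg; assumption)

theorem bihom_syzMat2 (hu : Bihom u 2 0) (hv : Bihom v 2 0) (hz : Bihom z 0 1) (hw : Bihom w 0 1)
    (j : Fin 5) (l : Fin 4) :
    Bihom (syzMat2 u v z w j l) ((ngColDeg2 l).1 - (ngColDeg1 j).1)
      ((ngColDeg2 l).2 - (ngColDeg1 j).2) := by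
  fin_cases j <;> fin_cases l <;> simp [syzMat2, ngColDeg1, ngColDeg2] <;>
  first
  | exact bihom_zero _ _
  | assumption
  | (apply Bihom.neg; assumption)

theorem bihom_syzMat3 (hu : Bihom u 2 0) (hv : Bihom v 2 0) (hz : Bihom z 0 1) (hw : Bihom w 0 1)
    (l : Fin 4) :
    Bihom (syzMat3 u v z w l 0) (6 - (ngColDeg2 l).1) (3 - (ngColDeg2 l).2) := by
  fin_cases l <;> simp [syzMat3, ngColDeg2] <;>
  first
  | assumption
  | (apply Bihom.neg; assumption)

/-- The change of generators of the ideal given by the rows of `c`, acting on syzygies. -/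
def baseChange (c : Matrix (Fin 3) (Fin 3) k) : Matrix (Fin 3) (Fin 3) (Rk k) :=
  c.transpose.map C

theorem baseChange_mul (c d : Matrix (Fin 3) (Fin 3) k) :
    baseChange c * baseChange d = baseChange (d * c) := by
  rw [baseChange, baseChange, baseChange, Matrix.transpose_mul, Matrix.map_mul]

theorem baseChange_one : baseChange (1 : Matrix (Fin 3) (Fin 3) k) = 1 := by
  rw [baseChange, Matrix.transpose_one, Matrix.map_one _ C_0 C_1]

theorem baseChange_mulVec_inv {c : Matrix (Fin 3) (Fin 3) k} (hc : c.det ≠ 0)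
    (A : Fin 3 → Rk k) : (baseChange c).mulVec ((baseChange c⁻¹).mulVec A) = A := by
  rw [Matrix.mulVec_mulVec, baseChange_mul, Matrix.nonsing_inv_mul _ (isUnit_iff_ne_zero.mpr hc),
    baseChange_one, Matrix.one_mulVec]

theorem baseChange_inv_mulVec {c : Matrix (Fin 3) (Fin 3) k} (hc : c.det ≠ 0)
    (A : Fin 3 → Rk k) : (baseChange c⁻¹).mulVec ((baseChange c).mulVec A) = A := by
  rw [Matrix.mulVec_mulVec, baseChange_mul, Matrix.mul_nonsing_inv _ (isUnit_iff_ne_zero.mpr hc),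
    baseChange_one, Matrix.one_mulVec]

end Resolution

/-- **Theorem 7.8.** In the non-generic case, `I = ⟨p0, p1, p2⟩` has the minimal
bigraded free resolution
`0 → R(−6,−3) → R(−4,−3)² ⊕ R(−6,−2)² → R(−6,−1) ⊕ R(−4,−2)³ ⊕ R(−2,−3) → R(−2,−1)³ → I → 0`,
expressed concretely via matrices whose entries are bihomogeneous of bidegree equal to the
column bidegree minus the row bidegree (entries of a bidegree with a negative coordinate being
forced to vanish, by the convention built into `Bihom`). -/
theorem statement18 {k : Type*} [Field k] [IsAlgClosed k] (p0 p1 p2 : Rk k)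
    (h0 : Bihom p0 2 1) (h1 : Bihom p1 2 1) (h2 : Bihom p2 2 1)
    (hncz : NoCommonZeros p0 p1 p2) (hgen : ¬ BidegGeneric p0 p1 p2) :
    ∃ (M1 : Matrix (Fin 3) (Fin 5) (Rk k)) (M2 : Matrix (Fin 5) (Fin 4) (Rk k))
      (M3 : Matrix (Fin 4) (Fin 1) (Rk k)),
      (∀ (i : Fin 3) (j : Fin 5),
        Bihom (M1 i j) ((ngColDeg1 j).1 - 2) ((ngColDeg1 j).2 - 1)) ∧
      (∀ (j : Fin 5) (l : Fin 4),
        Bihom (M2 j l) ((ngColDeg2 l).1 - (ngColDeg1 j).1) ((ngColDeg2 l).2 - (ngColDeg1 j).2)) ∧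
      (∀ l : Fin 4,
        Bihom (M3 l 0) (6 - (ngColDeg2 l).1) (3 - (ngColDeg2 l).2)) ∧
      Function.Injective (fun u : Fin 1 → Rk k => M3.mulVec u) ∧
      (∀ v : Fin 4 → Rk k, M2.mulVec v = 0 ↔ ∃ u : Fin 1 → Rk k, v = M3.mulVec u) ∧
      (∀ v : Fin 5 → Rk k, M1.mulVec v = 0 ↔ ∃ u : Fin 4 → Rk k, v = M2.mulVec u) ∧
      (∀ A : Fin 3 → Rk k,
        A 0 * p0 + A 1 * p1 + A 2 * p2 = 0 ↔ ∃ u : Fin 5 → Rk k, A = M1.mulVec u) ∧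
      (∀ r : Rk k,
        (∃ A : Fin 3 → Rk k, A 0 * p0 + A 1 * p1 + A 2 * p2 = r) ↔
          r ∈ Ideal.span ({p0, p1, p2} : Set (Rk k))) := by
  obtain ⟨a0, b0, rfl⟩ := h0.exists_biForm
  obtain ⟨a1, b1, rfl⟩ := h1.exists_biForm
  obtain ⟨a2, b2, rfl⟩ := h2.exists_biForm
  let a : Matrix (Fin 3) (Fin 3) k := ![a0, a1, a2]
  let b : Matrix (Fin 3) (Fin 3) k := ![b0, b1, b2]
  have H : RowsNoCommonZero a b := by
    intro x y r s hxy hrs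
    have := hncz x y r s hxy hrs
    simp only [eval_biForm] at this
    rcases this with h | h | h
    exacts [⟨0, h⟩, ⟨1, h⟩, ⟨2, h⟩]
  obtain ⟨c, u, v, hc, huv, hu0, hz0, hv1, hu1, hz2, hv2⟩ :=
    H.exists_normal_form (H.pencilCoeff_eq_zero hgen)
  have f0 := combination_biForm (c 0) a b
  have f1 := combination_biForm (c 1) a b
  have f2 := combination_biForm (c 2) a b
  rw [hu0, hz0] at f0
  rw [hv1, hu1] at f1
  rw [hz2, hv2] at f2
  have hq0 : quadPoly (0 : Fin 3 → k) = 0 := by simp [quadPoly]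
  simp only [biForm, hq0, mul_zero, add_zero, zero_add] at f0 f1 f2
  have hU := bihom_quadPoly u
  have hV := bihom_quadPoly v
  have hZ : Bihom (X 2 : Rk k) 0 1 := bihom_X 2
  have hW : Bihom (X 3 : Rk k) 0 1 := bihom_X 3
  have Q := huv.regularQuad
  have hsyz : ∀ A : Fin 3 → Rk k, ((baseChange c).mulVec A) 0 * biForm a0 b0 +
      ((baseChange c).mulVec A) 1 * biForm a1 b1 +
      ((baseChange c).mulVec A) 2 * biForm a2 b2 = 0 ↔
      ∃ x, A = (syzMat1 (quadPoly u) (quadPoly v) (X 2) (X 3)).mulVec x := by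
    intro A
    rw [← Q.syz_iff]
    suffices h : ((baseChange c).mulVec A) 0 * biForm a0 b0 +
      ((baseChange c).mulVec A) 1 * biForm a1 b1 +
      ((baseChange c).mulVec A) 2 * biForm a2 b2 = A 0 * (X 2 * quadPoly u) +
      A 1 * (X 3 * quadPoly u + X 2 * quadPoly v) + A 2 * (X 3 * quadPoly v) by rw [h]
    simp only [baseChange, Matrix.mulVec, dotProduct, Fin.sum_univ_three, Matrix.map_apply,
      Matrix.transpose_apply, biForm]
    simp only [a, b, Matrix.cons_val] at f0 f1 f2
    linear_combination A 0 * f0 + A 1 * f1 + A 2 * f2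
  refine ⟨baseChange c * syzMat1 (quadPoly u) (quadPoly v) (X 2) (X 3),
    syzMat2 (quadPoly u) (quadPoly v) (X 2) (X 3), syzMat3 (quadPoly u) (quadPoly v) (X 2) (X 3),
    fun i j => ?_, bihom_syzMat2 hU hV hZ hW, bihom_syzMat3 hU hV hZ hW, Q.syzMat3_injective,
    Q.syzMat2_exact, fun x => ?_, fun A => ?_, fun r => ?_⟩
  · rw [Matrix.mul_apply, Fin.sum_univ_three]
    have h := fun l => bihom_syzMat1 hU hV hZ hW l j
    exact (((h 0).C_mul _).add ((h 1).C_mul _)).add ((h 2).C_mul _)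
  · rw [← Q.syzMat1_exact huv.left_ne_zero, ← Matrix.mulVec_mulVec]
    refine ⟨fun h => ?_, fun h => by rw [h, Matrix.mulVec_zero]⟩
    rw [← baseChange_inv_mulVec hc (Matrix.mulVec _ x), h, Matrix.mulVec_zero]
  · have h := hsyz ((baseChange c⁻¹).mulVec A)
    rw [baseChange_mulVec_inv hc A] at h
    rw [h]
    refine exists_congr fun x => ⟨fun h => ?_, fun h => ?_⟩
    · rw [← Matrix.mulVec_mulVec, ← h, baseChange_mulVec_inv hc A]
    · rw [h, ← Matrix.mulVec_mulVec, baseChange_inv_mulVec hc]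
  · rw [Ideal.mem_span_insert]
    simp only [Ideal.mem_span_pair]
    constructor
    · rintro ⟨A, rfl⟩
      exact ⟨A 0, _, ⟨A 1, A 2, rfl⟩, add_assoc _ _ _⟩
    · rintro ⟨A0, _, ⟨A1, A2, rfl⟩, rfl⟩
      exact ⟨![A0, A1, A2], add_assoc _ _ _⟩
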